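/- Let ℓ be a prime number, K a number field with [K:ℚ] = ℓ, and p a prime number such that the ℚ_p-algebra K ⊗_ℚ ℚ_p is not a field. Then the norm map of the ℚ_p-algebra K ⊗_ℚ ℚ_p is surjective onto ℚ_p^×: for every a ∈ ℚ_p^× there exists x ∈ K ⊗_ℚ ℚ_p with N_{(K⊗ℚ_p)/ℚ_p}(x) = a. -/

import Mathlib

open scoped TensorProduct

/-- Norm on a product algebra. -/
theorem norm_prod_aux {F B C : Type*} [Field F] [CommRing B] [CommRing C] [Algebra F B]
    [Algebra F C] [Module.Finite F B] [Module.Finite F C] (b : B) (c : C) :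
    Algebra.norm F (b, c) = Algebra.norm F b * Algebra.norm F c := by
  rw [Algebra.norm_apply, Algebra.norm_apply, Algebra.norm_apply, ← LinearMap.det_prodMap]
  congr 1

theorem norm_surj_aux {F A : Type*} [Field F] [CommRing A] [Algebra F A] [Module.Finite F A]
    [Nontrivial A] [IsReduced A] (hprime : (Module.finrank F A).Prime) (hnf : ¬ IsField A)
    (a : F) (ha : a ≠ 0) : ∃ x : A, Algebra.norm F x = a := by
  have : IsArtinianRing A := IsArtinianRing.of_finite F A
  have : IsSemisimpleRing A := IsArtinianRing.isSemisimpleRing_of_isReduced A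
  obtain ⟨I, hI0, hI1⟩ := Ring.not_isField_iff_exists_ideal_bot_lt_and_lt_top.mp hnf
  obtain ⟨J, hJ⟩ := exists_isCompl I
  let f : A →ₐ[F] (A ⧸ I) × (A ⧸ J) :=
    AlgHom.prod (Ideal.Quotient.mkₐ F I) (Ideal.Quotient.mkₐ F J)
  have hf : Function.Bijective f := by
    constructor
    · rw [injective_iff_map_eq_zero]
      intro x hx
      have h1 : x ∈ I := Ideal.Quotient.eq_zero_iff_mem.mp (congrArg Prod.fst hx)
      have h2 : x ∈ J := Ideal.Quotient.eq_zero_iff_mem.mp (congrArg Prod.snd hx)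
      have : x ∈ I ⊓ J := ⟨h1, h2⟩
      rwa [hJ.inf_eq_bot] at this
    · rintro ⟨x, y⟩
      obtain ⟨x, rfl⟩ := Ideal.Quotient.mk_surjective x
      obtain ⟨y, rfl⟩ := Ideal.Quotient.mk_surjective y
      obtain ⟨i, hi, j, hj, hij⟩ := Submodule.mem_sup.mp
        (show (1 : A) ∈ I ⊔ J by rw [hJ.sup_eq_top]; trivial)
      refine ⟨x * j + y * i, Prod.ext ?_ ?_⟩
      · refine Ideal.Quotient.eq.mpr ?_
        have : x * j + y * i - x = (y - x) * i := by linear_combination x * hij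
        rw [this]
        exact I.mul_mem_left _ hi
      · refine Ideal.Quotient.eq.mpr ?_
        have : x * j + y * i - y = (x - y) * j := by linear_combination y * hij
        rw [this]
        exact J.mul_mem_left _ hj
  let e := AlgEquiv.ofBijective f hf
  have hJ1 : J ≠ ⊤ := by
    rintro rfl
    exact hI0.ne' (by simpa using hJ.inf_eq_bot)
  have : Nontrivial (A ⧸ I) := Ideal.Quotient.nontrivial_iff.mpr hI1.ne
  have : Nontrivial (A ⧸ J) := Ideal.Quotient.nontrivial_iff.mpr hJ1
  have hm : 0 < Module.finrank F (A ⧸ I) := Module.finrank_pos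
  have hn : 0 < Module.finrank F (A ⧸ J) := Module.finrank_pos
  have hsum : Module.finrank F A = Module.finrank F (A ⧸ I) + Module.finrank F (A ⧸ J) := by
    rw [e.toLinearEquiv.finrank_eq, Module.finrank_prod]
  set m := Module.finrank F (A ⧸ I) with hmd
  set n := Module.finrank F (A ⧸ J) with hnd
  have hc : Nat.gcd m n = 1 := by
    have h1 : Nat.Coprime m (m + n) :=
      (Nat.coprime_of_lt_prime hm.ne' (by omega) (hsum ▸ hprime)).symm
    simpa using h1
  have hbez := Nat.gcd_eq_gcd_ab m n
  rw [hc] at hbez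
  refine ⟨e.symm (algebraMap F _ (a ^ Nat.gcdA m n), algebraMap F _ (a ^ Nat.gcdB m n)), ?_⟩
  rw [Algebra.norm_eq_of_algEquiv, norm_prod_aux, Algebra.norm_algebraMap,
    Algebra.norm_algebraMap, ← hmd, ← hnd, ← zpow_natCast, ← zpow_natCast, ← zpow_mul, ← zpow_mul,
    ← zpow_add₀ ha, mul_comm, mul_comm _ (n : ℤ), ← hbez]
  simp

/-- If `ℓ` is a prime, `K` a number field of degree `ℓ` over `ℚ`, and `p` a prime such
that the `ℚ_p`-algebra `K ⊗_ℚ ℚ_p` is not a field, then the norm map of `K ⊗_ℚ ℚ_p` is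
surjective onto `ℚ_p^×`. -/
theorem norm_surjective_of_not_isField
    (ℓ : ℕ) (hℓ : ℓ.Prime)
    (K : Type) [Field K] [Algebra ℚ K] [FiniteDimensional ℚ K]
    (hKdeg : Module.finrank ℚ K = ℓ)
    (p : ℕ) [Fact p.Prime]
    (hnf : ¬ IsField (ℚ_[p] ⊗[ℚ] K)) :
    ∀ a : ℚ_[p], a ≠ 0 → ∃ x : ℚ_[p] ⊗[ℚ] K, Algebra.norm ℚ_[p] x = a := by
  intro a ha
  have : Algebra.FormallyUnramified ℚ K := Algebra.FormallyUnramified.of_isSeparable ℚ K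
  have : IsReduced (ℚ_[p] ⊗[ℚ] K) :=
    Algebra.FormallyUnramified.isReduced_of_field ℚ_[p] (ℚ_[p] ⊗[ℚ] K)
  refine norm_surj_aux ?_ hnf a ha
  rw [Module.finrank_baseChange, hKdeg]
  exact hℓ
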